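/- arXiv:2109.00318 — 5 statements merged into one kernel-verified Lean document; each statement's English description precedes it below -/
import Mathlib

section
/- (SP satisfies Inferential Weakening.) Let r be a real number with 0 ≤ r < 1 and let cs be a nonempty list of admissible weighted argument trees such that Str_sp C > 0 for every C in cs. Then Str_sp (node r cs) < Str_sp C for every C in cs; in particular Str_sp (node r cs) is strictly less than the minimum of the strengths of the trees in cs. -/
/-- A weighted argument tree: a leaf states a premise with a weight,
a node applies an inference rule with a weight to a list of antecedent trees. -/
inductive T where
  | leaf : ℝ → T
  | node : ℝ → List T → T

/-- The multiset of all weights occurring in a tree. -/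
def basis : T → Multiset ℝ
  | .leaf w => {w}
  | .node r cs => r ::ₘ (cs.attach.map (fun c => basis c.1)).sum
decreasing_by
  have := List.sizeOf_lt_of_mem c.2
  simp only [T.node.sizeOf_spec]
  omega

/-- A tree is admissible if every weight in its basis lies in [0,1]. -/
def admissible (A : T) : Prop := ∀ b ∈ basis A, b ∈ Set.Icc (0:ℝ) 1

/-- Simple product method: the product of all weights in the basis (with multiplicity). -/
noncomputable def Str_sp (A : T) : ℝ := (basis A).prod

/-- Weakest link method: the minimum of the weights in the basis. -/
noncomputable def Str_wl (A : T) : ℝ := sInf {x | x ∈ basis A}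

theorem Str_sp_node (r : ℝ) (cs : List T) :
    Str_sp (T.node r cs) = r * (cs.map Str_sp).prod := by
  have prod_sum (l : List (Multiset ℝ)) : l.sum.prod = (l.map Multiset.prod).prod := by
    induction l with
    | nil => simp
    | cons a l ih => simp [ih]
  rw [Str_sp, basis, Multiset.prod_cons, List.attach_map_val, prod_sum, List.map_map]
  rfl

theorem Str_sp_le_one {A : T} (hA : admissible A) : Str_sp A ≤ 1 :=
  (multiset_prod_mem (S := unitInterval.submonoid) (basis A) hA).2

theorem prod_map_le_of_mem {α : Type*} {f : α → ℝ} {l : List α} (hpos : ∀ a ∈ l, 0 ≤ f a)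
    (hle : ∀ a ∈ l, f a ≤ 1) {a : α} (ha : a ∈ l) : (l.map f).prod ≤ f a := by
  obtain ⟨s, t, rfl⟩ := List.append_of_mem ha
  have hprod (l' : List α) (hl' : ∀ b ∈ l', b ∈ s ++ a :: t) :
      (l'.map f).prod ∈ Set.Icc (0 : ℝ) 1 := by
    refine list_prod_mem (S := unitInterval.submonoid) fun x hx => ?_
    obtain ⟨b, hb, rfl⟩ := List.mem_map.1 hx
    exact ⟨hpos b (hl' b hb), hle b (hl' b hb)⟩
  have hs := hprod s (by simp +contextual)
  have ht := hprod t (by simp +contextual)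
  rw [List.map_append, List.map_cons, List.prod_append, List.prod_cons, mul_left_comm]
  exact mul_le_of_le_one_right (hpos a ha) (mul_le_one₀ hs.2 ht.1 ht.2)

theorem sp_inferential_weakening (r : ℝ) (hr0 : 0 ≤ r) (hr1 : r < 1)
    (cs : List T) (hne : cs ≠ [])
    (hadm : ∀ C ∈ cs, admissible C)
    (hpos : ∀ C ∈ cs, 0 < Str_sp C) :
    ∀ C ∈ cs, Str_sp (T.node r cs) < Str_sp C := by
  intro C hC
  have hle : (cs.map Str_sp).prod ≤ Str_sp C :=
    prod_map_le_of_mem (fun D hD => (hpos D hD).le) (fun D hD => Str_sp_le_one (hadm D hD)) hC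
  rw [Str_sp_node]
  calc r * (cs.map Str_sp).prod ≤ r * Str_sp C := mul_le_mul_of_nonneg_left hle hr0
    _ < Str_sp C := mul_lt_of_lt_one_left (hpos C hC) hr1
end

section
/- (SP satisfies Inference Weight Sensitivity.) Let r and r' be real numbers with 0 ≤ r < r' and let cs be a list of admissible weighted argument trees such that Str_sp C > 0 for every C in cs. Then Str_sp (node r cs) < Str_sp (node r' cs). -/
theorem sp_inference_weight_sensitivity (r r' : ℝ) (hr0 : 0 ≤ r) (hrr' : r < r')
    (cs : List T)
    (hadm : ∀ C ∈ cs, admissible C)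
    (hpos : ∀ C ∈ cs, 0 < Str_sp C) :
    Str_sp (T.node r cs) < Str_sp (T.node r' cs) := by
  rw [Str_sp_node, Str_sp_node]
  exact mul_lt_mul_of_pos_right hrr' (List.prod_pos (by simpa using hpos))
end

section
/- (SP satisfies Antecedent Weakening.) Let r be a real number, cs a list of weighted argument trees with Str_sp (node r cs) > 0, and B an admissible weighted argument tree with Str_sp B < 1. Then Str_sp (node r (B :: cs)) < Str_sp (node r cs): adding an antecedent of strength less than 1 strictly lowers the strength of an argument whose strength is positive. -/
theorem basis_node (r : ℝ) (cs : List T) :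
    basis (T.node r cs) = r ::ₘ (cs.map basis).sum := by
  rw [basis, List.attach_map_val (f := basis)]

theorem Str_sp_node_cons (r : ℝ) (B : T) (cs : List T) :
    Str_sp (T.node r (B :: cs)) = Str_sp B * Str_sp (T.node r cs) := by
  simp only [Str_sp, basis_node, List.map_cons, List.sum_cons, Multiset.prod_cons,
    Multiset.prod_add]
  ring

theorem sp_antecedent_weakening (r : ℝ) (cs : List T) (B : T)
    (hpos : 0 < Str_sp (T.node r cs))
    (hB : admissible B) (hB1 : Str_sp B < 1) :
    Str_sp (T.node r (B :: cs)) < Str_sp (T.node r cs) := by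
  rw [Str_sp_node_cons]
  exact mul_lt_of_lt_one_left hpos hB1
end

section
/- (WL satisfies Antecedent Maximality.) Let r be a real number with 0 ≤ r ≤ 1 and let cs be a list of admissible weighted argument trees such that Str_wl C = 1 for every C in cs. Then Str_wl (node r cs) = r. -/
theorem mem_basis_node {r b : ℝ} {cs : List T} :
    b ∈ basis (T.node r cs) ↔ b = r ∨ ∃ C ∈ cs, b ∈ basis C := by
  have mem_sum : ∀ l : List (Multiset ℝ), b ∈ l.sum ↔ ∃ s ∈ l, b ∈ s := by
    intro l
    induction l with
    | nil => simp
    | cons s l ih => simp [ih]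
  rw [basis, Multiset.mem_cons, mem_sum]
  simp

theorem Str_wl_le_of_mem_basis {A : T} (hA : admissible A) {b : ℝ} (hb : b ∈ basis A) :
    Str_wl A ≤ b :=
  csInf_le ⟨0, fun x hx => (hA x hx).1⟩ hb

theorem wl_antecedent_maximality (r : ℝ) (hr0 : 0 ≤ r) (hr1 : r ≤ 1)
    (cs : List T) (hadm : ∀ C ∈ cs, admissible C)
    (h1 : ∀ C ∈ cs, Str_wl C = 1) :
    Str_wl (T.node r cs) = r := by
  have hmin : ∀ b ∈ basis (T.node r cs), r ≤ b := by
    intro b hb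
    rcases mem_basis_node.1 hb with rfl | ⟨C, hC, hbC⟩
    · exact le_rfl
    · calc r ≤ 1 := hr1
        _ = Str_wl C := (h1 C hC).symm
        _ ≤ b := Str_wl_le_of_mem_basis (hadm C hC) hbC
  exact IsLeast.csInf_eq ⟨mem_basis_node.2 (Or.inl rfl), hmin⟩
end

section
/- (Well-behaved aggregation methods satisfy Strict Argument.) Let (f,g) be a well-behaved aggregation method and let A be a weighted argument tree such that every element of basis A equals 1. Then Str_{f,g} A = 1. -/
/-- The (f,g)-strength of a weighted argument tree: g aggregates the strengths of
the antecedents and f combines the rule/premise weight with that aggregate. -/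
def Str (f : ℝ → ℝ → ℝ) (g : List ℝ → ℝ) : T → ℝ
  | .leaf w => f w (g [])
  | .node r cs => f r (g (cs.attach.map (fun c => Str f g c.1)))
decreasing_by
  have := List.sizeOf_lt_of_mem c.2
  simp only [T.node.sizeOf_spec]
  omega

/-- A well-behaved aggregation method. -/
structure WellBehaved (f : ℝ → ℝ → ℝ) (g : List ℝ → ℝ) : Prop where
  f_mem : ∀ x ∈ Set.Icc (0:ℝ) 1, ∀ y ∈ Set.Icc (0:ℝ) 1, f x y ∈ Set.Icc (0:ℝ) 1
  g_mem : ∀ l : List ℝ, (∀ x ∈ l, x ∈ Set.Icc (0:ℝ) 1) → g l ∈ Set.Icc (0:ℝ) 1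
  g_perm : ∀ l l' : List ℝ, l.Perm l' → g l = g l'
  f_mono_left : ∀ x x' y : ℝ, x ∈ Set.Icc (0:ℝ) 1 → x' ∈ Set.Icc (0:ℝ) 1 →
    y ∈ Set.Icc (0:ℝ) 1 → x ≠ 0 → y ≠ 0 → x ≤ x' → f x y ≤ f x' y
  f_mono_right : ∀ x y y' : ℝ, x ∈ Set.Icc (0:ℝ) 1 → y ∈ Set.Icc (0:ℝ) 1 →
    y' ∈ Set.Icc (0:ℝ) 1 → x ≠ 0 → y ≠ 0 → y ≤ y' → f x y ≤ f x y'
  f_zero_left : ∀ x ∈ Set.Icc (0:ℝ) 1, f 0 x = 0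
  f_zero_right : ∀ x ∈ Set.Icc (0:ℝ) 1, f x 0 = 0
  f_one_right : ∀ x ∈ Set.Icc (0:ℝ) 1, f x 1 = x
  f_one_left : ∀ x ∈ Set.Icc (0:ℝ) 1, f 1 x = x
  g_nil : g [] = 1
  g_single : ∀ x ∈ Set.Icc (0:ℝ) 1, g [x] = x
  g_zero : ∀ l : List ℝ, (∀ x ∈ l, x ∈ Set.Icc (0:ℝ) 1) → g (l ++ [0]) = 0
  g_one : ∀ l : List ℝ, (∀ x ∈ l, x ∈ Set.Icc (0:ℝ) 1) → g (l ++ [1]) = g l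
  g_mono : ∀ l : List ℝ, (∀ x ∈ l, x ∈ Set.Icc (0:ℝ) 1) →
    ∀ y z : ℝ, y ∈ Set.Icc (0:ℝ) 1 → z ∈ Set.Icc (0:ℝ) 1 → y ≤ z →
      g (l ++ [y]) ≤ g (l ++ [z])

theorem basis_le_basis_node (r : ℝ) {c : T} {cs : List T} (hc : c ∈ cs) :
    basis c ≤ basis (.node r cs) := by
  rw [basis, List.attach_map_val (f := basis)]
  exact (List.single_le_sum (fun _ _ => zero_le) _ (List.mem_map_of_mem hc)).trans
    (Multiset.le_cons_self _ _)

theorem WellBehaved.g_replicate_one {f : ℝ → ℝ → ℝ} {g : List ℝ → ℝ} (hwb : WellBehaved f g)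
    (n : ℕ) : g (List.replicate n 1) = 1 := by
  induction n with
  | zero => exact hwb.g_nil
  | succ n ih =>
    rw [List.replicate_succ', hwb.g_one _ fun x hx => ?_, ih]
    simp [List.eq_of_mem_replicate hx]

theorem wellBehaved_strict_argument (f : ℝ → ℝ → ℝ) (g : List ℝ → ℝ)
    (hwb : WellBehaved f g) (A : T) (h : ∀ b ∈ basis A, b = 1) :
    Str f g A = 1 := by
  have f_one_one : f 1 1 = 1 := hwb.f_one_left 1 (by simp)
  match A with
  | .leaf w =>
    rw [Str, hwb.g_nil, h w (by simp [basis]), f_one_one]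
  | .node r cs =>
    have strength_one : ∀ c ∈ cs, Str f g c = 1 := fun c hc =>
      wellBehaved_strict_argument f g hwb c fun b hb =>
        h b (Multiset.mem_of_le (basis_le_basis_node r hc) hb)
    rw [Str, List.attach_map_val (f := Str f g), List.map_congr_left strength_one,
      List.map_const', hwb.g_replicate_one, h r (by simp [basis]), f_one_one]
termination_by sizeOf A
decreasing_by
  have := List.sizeOf_lt_of_mem hc
  simp only [T.node.sizeOf_spec]
  omega
end
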